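/- arXiv:2109.01701 — 10 statements merged into one kernel-verified Lean document; each statement's English description precedes it below -/
import Mathlib

section
/- Let Z be a set, v ∈ {-1,1}^n, and H a v-hierarchical clustering of Z. If P ⊆ R^v is the support of a layer of Γ(H), then P = U_P ∩ D_P. -/
/-- The partial order on `R^v`: coordinate `i` uses the usual order on `ℝ`
if `v i = true` (i.e. `v_i = 1`) and the opposite order if `v i = false` (i.e. `v_i = -1`). -/
def vle {n : ℕ} (v : Fin n → Bool) (s t : Fin n → ℝ) : Prop :=
  ∀ i, if v i then s i ≤ t i else t i ≤ s i

/-- A clustering of `Z`: a set of pairwise disjoint nonempty subsets of `Z`. -/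
def IsClustering {Z : Type*} (A : Set (Set Z)) : Prop :=
  (∀ S ∈ A, S.Nonempty) ∧ (∀ S ∈ A, ∀ T ∈ A, S ≠ T → Disjoint S T)

/-- The partial order on clusterings: `A ≤ B` iff every cluster of `A` is contained
in some cluster of `B`. -/
def ClusterLE {Z : Type*} (A B : Set (Set Z)) : Prop :=
  ∀ S ∈ A, ∃ T ∈ B, S ⊆ T

/-- A `v`-hierarchical clustering of `Z`: an order-preserving map `R^v → C(Z)`
which is empty somewhere. -/
def IsHC {Z : Type*} {n : ℕ} (v : Fin n → Bool) (H : (Fin n → ℝ) → Set (Set Z)) : Prop :=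
  (∀ s, IsClustering (H s)) ∧ (∀ s t, vle v s t → ClusterLE (H s) (H t)) ∧ (∃ s, H s = ∅)

/-- The generating relation for the layer equivalence on `Γ(H)`:
`(s,S) ∼ (t,S)` whenever `s ≤ t` and `S ∈ H s ∩ H t`. -/
def layerRel {Z : Type*} {n : ℕ} (v : Fin n → Bool) (H : (Fin n → ℝ) → Set (Set Z)) :
    (Fin n → ℝ) × Set Z → (Fin n → ℝ) × Set Z → Prop :=
  fun a b => a.2 = b.2 ∧ vle v a.1 b.1 ∧ a.2 ∈ H a.1 ∧ a.2 ∈ H b.1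

/-- Two elements of `Γ(H)` lie in the same layer. -/
def SameLayer {Z : Type*} {n : ℕ} (v : Fin n → Bool) (H : (Fin n → ℝ) → Set (Set Z))
    (a b : (Fin n → ℝ) × Set Z) : Prop :=
  Relation.EqvGen (layerRel v H) a b

/-- The support of the layer of `(s, S)` in `Γ(H)`. -/
def layerSupp {Z : Type*} {n : ℕ} (v : Fin n → Bool) (H : (Fin n → ℝ) → Set (Set Z))
    (s : Fin n → ℝ) (S : Set Z) : Set (Fin n → ℝ) :=
  {p | S ∈ H p ∧ SameLayer v H (p, S) (s, S)}

/-- The up-set `U_P` of `P ⊆ R^v`. -/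
def upSet {n : ℕ} (v : Fin n → Bool) (P : Set (Fin n → ℝ)) : Set (Fin n → ℝ) :=
  {r | ∃ p ∈ P, vle v p r}

/-- The down-set `D_P` of `P ⊆ R^v`. -/
def downSet {n : ℕ} (v : Fin n → Bool) (P : Set (Fin n → ℝ)) : Set (Fin n → ℝ) :=
  {r | ∃ p ∈ P, vle v r p}

/-- `(s, S)` is a global layer point of `Γ(H)`: every `(t,T) ∈ Γ(H)` with
`(t,T) < (s,S)` satisfies `T ≠ S`. -/
def GlobalLayerPoint {Z : Type*} {n : ℕ} (v : Fin n → Bool)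
    (H : (Fin n → ℝ) → Set (Set Z)) (s : Fin n → ℝ) (S : Set Z) : Prop :=
  S ∈ H s ∧ ∀ t T, T ∈ H t → vle v t s → T ⊆ S → (t, T) ≠ (s, S) → T ≠ S

/-- `(s, S)` is an `i`-th parameter layer point of `Γ(H)`. -/
def IthLayerPoint {Z : Type*} {n : ℕ} (v : Fin n → Bool)
    (H : (Fin n → ℝ) → Set (Set Z)) (i : Fin n) (s : Fin n → ℝ) (S : Set Z) : Prop :=
  S ∈ H s ∧ ∀ t : ℝ, (if v i then t < s i else s i < t) →
    ∀ T ∈ H (Function.update s i t), T ⊆ S → T ≠ S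

theorem vle_refl {n : ℕ} (v : Fin n → Bool) (s : Fin n → ℝ) : vle v s s := by
  intro i
  split <;> exact le_rfl

/-- A cluster present at two comparable parameters is present at every parameter between them. -/
theorem IsHC.mem_of_vle_of_vle {Z : Type*} {n : ℕ} {v : Fin n → Bool}
    {H : (Fin n → ℝ) → Set (Set Z)} (hH : IsHC v H) {p r q : Fin n → ℝ} {S : Set Z}
    (hp : S ∈ H p) (hq : S ∈ H q) (hpr : vle v p r) (hrq : vle v r q) : S ∈ H r := by
  obtain ⟨hC, hmono, -⟩ := hH
  obtain ⟨T, hT, hST⟩ := hmono p r hpr S hp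
  obtain ⟨W, hW, hTW⟩ := hmono r q hrq T hT
  obtain ⟨z, hz⟩ := (hC p).1 S hp
  have hS : S = W := by
    by_contra hne
    exact Set.disjoint_left.1 ((hC q).2 S hq W hW hne) hz (hTW (hST hz))
  rwa [hST.antisymm (hS ▸ hTW)]

/-- If `P ⊆ R^v` is the support of a layer of `Γ(H)`, then
`P = U_P ∩ D_P`. -/
theorem statement0 {Z : Type*} {n : ℕ} (v : Fin n → Bool)
    (H : (Fin n → ℝ) → Set (Set Z)) (hH : IsHC v H)
    (s₀ : Fin n → ℝ) (S : Set Z) (hS : S ∈ H s₀)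
    (P : Set (Fin n → ℝ)) (hP : P = layerSupp v H s₀ S) :
    P = upSet v P ∩ downSet v P := by
  subst hP
  ext r
  constructor
  · intro hr
    exact ⟨⟨r, hr, vle_refl v r⟩, ⟨r, hr, vle_refl v r⟩⟩
  · rintro ⟨⟨p, ⟨hp, hps⟩, hpr⟩, ⟨q, ⟨hq, -⟩, hrq⟩⟩
    have hr : S ∈ H r := hH.mem_of_vle_of_vle hp hq hpr hrq
    exact ⟨hr, .trans _ (p, S) _ (.symm _ _ (.rel _ _ ⟨rfl, hpr, hp, hr⟩)) hps⟩
end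

section
/- Let Z be a set, v ∈ {-1,1}^n, H a v-hierarchical clustering of Z, and S ⊆ Z. Let Supp(S) = {s ∈ R^v : S ∈ H(s)}. Then Supp(S) = U_{Supp(S)} ∩ D_{Supp(S)}. -/
/-- A cluster of `A` contained in another cluster of `A` is equal to it. -/
theorem IsClustering.eq_of_subset {Z : Type*} {A : Set (Set Z)} (hA : IsClustering A)
    {S T : Set Z} (hS : S ∈ A) (hT : T ∈ A) (hST : S ⊆ T) : S = T := by
  by_contra hne
  obtain ⟨x, hx⟩ := hA.1 S hS
  exact Set.disjoint_left.1 (hA.2 S hS T hT hne) hx (hST hx)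

/-- For any `S ⊆ Z`, `Supp(S) = U_{Supp(S)} ∩ D_{Supp(S)}`. -/
theorem statement1 {Z : Type*} {n : ℕ} (v : Fin n → Bool)
    (H : (Fin n → ℝ) → Set (Set Z)) (hH : IsHC v H) (S : Set Z) :
    {s | S ∈ H s} = upSet v {s | S ∈ H s} ∩ downSet v {s | S ∈ H s} := by
  ext r
  constructor
  · exact fun hr => ⟨⟨r, hr, vle_refl v r⟩, ⟨r, hr, vle_refl v r⟩⟩
  · rintro ⟨⟨p, hp, hpr⟩, ⟨q, hq, hrq⟩⟩
    obtain ⟨T, hT, hST⟩ := hH.2.1 p r hpr S hp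
    obtain ⟨T', hT', hTT'⟩ := hH.2.1 r q hrq T hT
    have hSq : S = T' := (hH.1 q).eq_of_subset hq hT' (hST.trans hTT')
    have hSr : S = T := hST.antisymm (hSq ▸ hTT')
    exact hSr ▸ hT
end

section
/- Let Z be a set with a nonempty proper subset W ⊊ Z, let v ∈ {-1,1}^n, and let P ⊆ R^v be a nonempty set satisfying P = U_P ∩ D_P and U_P ≠ R^v. Define H : R^v → C(Z) by H(s) = ∅ if s ∉ U_P, H(s) = {W} if s ∈ P, and H(s) = {Z} if s ∈ U_P ∖ P. Then H is a v-hierarchical clustering of Z (i.e., H is order-preserving and H(s) = ∅ for some s), and {s ∈ R^v : W ∈ H(s)} = P. -/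
theorem vle_trans {n : ℕ} {v : Fin n → Bool} {r s t : Fin n → ℝ}
    (hrs : vle v r s) (hst : vle v s t) : vle v r t := by
  intro i
  have h₁ := hrs i
  have h₂ := hst i
  split_ifs at * with h
  · exact h₁.trans h₂
  · exact h₂.trans h₁

theorem mem_upSet_of_vle {n : ℕ} {v : Fin n → Bool} {P : Set (Fin n → ℝ)} {s t : Fin n → ℝ}
    (hs : s ∈ upSet v P) (hst : vle v s t) : t ∈ upSet v P := by
  obtain ⟨p, hp, hps⟩ := hs
  exact ⟨p, hp, vle_trans hps hst⟩

theorem isClustering_empty {Z : Type*} : IsClustering (∅ : Set (Set Z)) := by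
  simp [IsClustering]

theorem isClustering_singleton {Z : Type*} {S : Set Z} (hS : S.Nonempty) :
    IsClustering ({S} : Set (Set Z)) := by
  simp [IsClustering, hS]

/-- Given a nonempty proper subset `W ⊊ Z` and a nonempty set
`P ⊆ R^v` with `P = U_P ∩ D_P` and `U_P ≠ R^v`, the map `H` with `H s = ∅` for
`s ∉ U_P`, `H s = {W}` for `s ∈ P` and `H s = {Z}` for `s ∈ U_P \ P` is a
`v`-hierarchical clustering of `Z` with `{s : W ∈ H s} = P`. -/
theorem statement3 {Z : Type*} {n : ℕ} (v : Fin n → Bool)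
    (W : Set Z) (hWne : W.Nonempty) (hWproper : W ≠ Set.univ)
    (P : Set (Fin n → ℝ)) (hPne : P.Nonempty)
    (hP : P = upSet v P ∩ downSet v P) (hU : upSet v P ≠ Set.univ)
    (H : (Fin n → ℝ) → Set (Set Z))
    (hH1 : ∀ s ∈ P, H s = {W})
    (hH2 : ∀ s, s ∈ upSet v P → s ∉ P → H s = {(Set.univ : Set Z)})
    (hH3 : ∀ s, s ∉ upSet v P → H s = ∅) :
    IsHC v H ∧ {s | W ∈ H s} = P := by
  refine ⟨⟨fun s => ?_, fun s t hst => ?_, ?_⟩, ?_⟩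
  · by_cases hsU : s ∈ upSet v P
    · by_cases hsP : s ∈ P
      · rw [hH1 s hsP]
        exact isClustering_singleton hWne
      · rw [hH2 s hsU hsP]
        exact isClustering_singleton (hWne.mono (Set.subset_univ W))
    · rw [hH3 s hsU]
      exact isClustering_empty
  · intro S hS
    by_cases hsU : s ∈ upSet v P
    · have htU := mem_upSet_of_vle hsU hst
      by_cases htP : t ∈ P
      · have hsP : s ∈ P := by
          rw [hP]
          exact ⟨hsU, t, htP, hst⟩
        rw [hH1 s hsP] at hS
        rw [hH1 t htP]
        exact ⟨S, hS, subset_rfl⟩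
      · rw [hH2 t htU htP]
        exact ⟨Set.univ, rfl, Set.subset_univ S⟩
    · simp [hH3 s hsU] at hS
  · obtain ⟨s, hs⟩ := (Set.ne_univ_iff_exists_notMem _).1 hU
    exact ⟨s, hH3 s hs⟩
  · ext s
    refine ⟨fun hs => ?_, fun hs => by simp [hH1 s hs]⟩
    by_contra hsP
    by_cases hsU : s ∈ upSet v P
    · exact hWproper (by simpa [hH2 s hsU hsP] using hs)
    · simp [hH3 s hsU] at hs
end

section
/- Let Z be a set, v ∈ {-1,1}^n, and H a v-hierarchical clustering of Z. An element (s,S) ∈ Γ(H) is a global layer point if and only if it is an i-th parameter layer point for every 1 ≤ i ≤ n. -/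
/-- If a cluster persists from `t` to `s`, it is a cluster at every intermediate parameter. -/
theorem IsHC.mem_of_vle_of_vle_s5 {Z : Type*} {n : ℕ} {v : Fin n → Bool}
    {H : (Fin n → ℝ) → Set (Set Z)} (hH : IsHC v H) {t u s : Fin n → ℝ} {S : Set Z}
    (htu : vle v t u) (hus : vle v u s) (ht : S ∈ H t) (hs : S ∈ H s) : S ∈ H u := by
  obtain ⟨T, hT, hST⟩ := hH.2.1 t u htu S ht
  obtain ⟨T', hT', hTT'⟩ := hH.2.1 u s hus T hT
  have hSne : S.Nonempty := (hH.1 s).1 S hs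
  have hST' : S = T' := by
    by_contra hne
    obtain ⟨x, hx⟩ := hSne
    exact Set.disjoint_left.mp ((hH.1 s).2 S hs T' hT' hne) hx (hTT' (hST hx))
  subst hST'
  rwa [hST.antisymm hTT']

/-- `(s,S) ∈ Γ(H)` is a global layer point iff it is an `i`-th
parameter layer point for every `i`. -/
theorem statement5 {Z : Type*} {n : ℕ} (v : Fin n → Bool)
    (H : (Fin n → ℝ) → Set (Set Z)) (hH : IsHC v H)
    (s : Fin n → ℝ) (S : Set Z) (hS : S ∈ H s) :
    GlobalLayerPoint v H s S ↔ ∀ i : Fin n, IthLayerPoint v H i s S := by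
  constructor
  · rintro ⟨-, hglobal⟩ i
    refine ⟨hS, fun t ht T hT hTS => hglobal _ T hT (fun j => ?_) hTS fun heq => ?_⟩
    · rcases eq_or_ne j i with rfl | hj
      · rw [Function.update_self]
        split_ifs at ht ⊢ <;> exact ht.le
      · simp [Function.update_of_ne hj]
    · have hti : t = s i := by
        simpa using congrFun (congrArg Prod.fst heq) i
      subst hti
      split_ifs at ht <;> exact lt_irrefl _ ht
  · refine fun hlayer => ⟨hS, ?_⟩
    rintro t T hT hts - hne rfl
    obtain ⟨i, hi⟩ : ∃ i, t i ≠ s i := by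
      by_contra! hall
      exact hne (by rw [funext hall])
    refine (hlayer i).2 (t i) ?_ T (hH.mem_of_vle_of_vle_s5 (t := t) ?_ ?_ hT hS) subset_rfl rfl
    · have hle := hts i
      split_ifs at hle ⊢
      exacts [lt_of_le_of_ne hle hi, lt_of_le_of_ne hle hi.symm]
    · intro j
      rcases eq_or_ne j i with rfl | hj
      · simp
      · simpa [Function.update_of_ne hj] using hts j
    · intro j
      rcases eq_or_ne j i with rfl | hj
      · simpa using hts j
      · simp [Function.update_of_ne hj]
end

section
/- Let Z be a set, v ∈ {-1,1}^n, H a v-hierarchical clustering of Z, and 1 ≤ i, j ≤ n with i ≠ j. Suppose (s,S) ∈ Γ(H) is an i-th parameter layer point, and suppose (t,S) ∈ Γ(H) satisfies t ≤ s in R^v and t agrees with s in every coordinate except possibly the j-th (so that, in particular, if (t,S) is the maximal j-th parameter layer point below (s,S), these hypotheses hold). Then (t,S) is an i-th parameter layer point. -/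
/-- If `(s,S)` is an `i`-th parameter layer point and `(t,S) ∈ Γ(H)`
satisfies `t ≤ s` with `t` agreeing with `s` in every coordinate except possibly the
`j`-th, then `(t,S)` is an `i`-th parameter layer point. -/
theorem statement6 {Z : Type*} {n : ℕ} (v : Fin n → Bool)
    (H : (Fin n → ℝ) → Set (Set Z)) (hH : IsHC v H)
    (i j : Fin n) (hij : i ≠ j) (s t : Fin n → ℝ) (S : Set Z)
    (hi : IthLayerPoint v H i s S) (htS : S ∈ H t) (hts : vle v t s)
    (hagree : ∀ m, m ≠ j → t m = s m) :
    IthLayerPoint v H i t S := by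
  refine ⟨htS, fun u hu T hT _ hTS => ?_⟩
  subst hTS
  rw [hagree i hij] at hu
  have h₁ : vle v (Function.update t i u) (Function.update s i u) := by
    intro m
    by_cases hm : m = i
    · subst hm
      simp
    · simpa [hm] using hts m
  have h₂ : vle v (Function.update s i u) s := by
    intro m
    by_cases hm : m = i
    · subst hm
      cases hv : v m <;> simp [hv] at hu ⊢ <;> exact hu.le
    · simp [hm]
  obtain ⟨A, hA, hTA⟩ := hH.2.1 _ _ h₁ T hT
  obtain ⟨B, hB, hAB⟩ := hH.2.1 _ _ h₂ A hA
  obtain ⟨x, hx⟩ := (hH.1 s).1 T hi.1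
  have hBT : B = T := by
    by_contra hne
    exact Set.disjoint_left.1 ((hH.1 s).2 B hB T hi.1 hne) (hAB (hTA hx)) hx
  subst hBT
  exact hi.2 u hu A hA hAB (hAB.antisymm hTA)
end

section
/- Let H and E be single-parameter hierarchical clusterings of a set Z, both closed below, and let (f,g) give an (ε,δ)-interleaving of (H,E) with ε, δ ≥ 0. For (s,S) ∈ Γ(H), let m_H(s,S) denote the unique maximal layer point of H below (s,S) (which exists since H is closed below), and define m_E similarly. Define F : Λ(H) → Λ(E) by F(s,S) = m_E(s+ε, f_ε(S)) and G : Λ(E) → Λ(H) by G(t,T) = m_H(t+δ, g_δ(T)). Then F and G are order-preserving, and: (i) for every (s,S) ∈ Λ(H), G(F(s,S)) ≤ m_H(s+ε+δ, S̄), where S̄ is the cluster of H(s+ε+δ) containing S; (ii) for every (t,T) ∈ Λ(E), F(G(t,T)) ≤ m_E(t+ε+δ, T̄), where T̄ is the cluster of E(t+ε+δ) containing T. -/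
/-- A single-parameter hierarchical clustering of `Z`. -/
def IsHC1 {Z : Type*} (H : ℝ → Set (Set Z)) : Prop :=
  (∀ s, IsClustering (H s)) ∧ (∀ s t : ℝ, s ≤ t → ClusterLE (H s) (H t)) ∧ (∃ s, H s = ∅)

/-- Generating relation for the layer equivalence, single-parameter case. -/
def layerRel1 {Z : Type*} (H : ℝ → Set (Set Z)) : ℝ × Set Z → ℝ × Set Z → Prop :=
  fun a b => a.2 = b.2 ∧ a.1 ≤ b.1 ∧ a.2 ∈ H a.1 ∧ a.2 ∈ H b.1

/-- The support of the layer of `(s, S)`, single-parameter case. -/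
def layerSupp1 {Z : Type*} (H : ℝ → Set (Set Z)) (s : ℝ) (S : Set Z) : Set ℝ :=
  {p | S ∈ H p ∧ Relation.EqvGen (layerRel1 H) (p, S) (s, S)}

/-- `H` is closed below: the infimum of the support of every layer belongs to the support. -/
def ClosedBelow1 {Z : Type*} (H : ℝ → Set (Set Z)) : Prop :=
  ∀ s S, S ∈ H s → sInf (layerSupp1 H s S) ∈ layerSupp1 H s S

/-- `(s, S)` is a layer point of `Γ(H)`, single-parameter case. -/
def LayerPoint1 {Z : Type*} (H : ℝ → Set (Set Z)) (s : ℝ) (S : Set Z) : Prop :=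
  S ∈ H s ∧ ∀ t T, T ∈ H t → t ≤ s → T ⊆ S → (t, T) ≠ (s, S) → T ≠ S

/-- A cluster at an earlier parameter lies in any later cluster that it meets. -/
theorem IsHC1.cluster_subset {Z : Type*} {H : ℝ → Set (Set Z)} (hH : IsHC1 H) {s t : ℝ}
    {S T : Set Z} {x : Z} (hS : S ∈ H s) (hT : T ∈ H t) (hst : s ≤ t) (hxS : x ∈ S)
    (hxT : x ∈ T) : S ⊆ T := by
  obtain ⟨R, hR, hSR⟩ := hH.2.1 s t hst S hS
  have hRT : R = T := by
    by_contra hne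
    exact Set.disjoint_left.mp ((hH.1 t).2 R hR T hT hne) (hSR hxS) hxT
  exact hRT ▸ hSR

/-- The cluster map of an interleaving is monotone in both the parameter and the cluster. -/
theorem IsHC1.clusterMap_mono {Z : Type*} {H E : ℝ → Set (Set Z)} (hH : IsHC1 H)
    (hE : IsHC1 E) {f : Z → Z} {ε : ℝ} {φ : ℝ → Set Z → Set Z}
    (hφ : ∀ s S, S ∈ H s → φ s S ∈ E (s + ε) ∧ f '' S ⊆ φ s S) {s s' : ℝ} {S S' : Set Z}
    (hS : S ∈ H s) (hS' : S' ∈ H s') (hs : s ≤ s') (hSS' : S ⊆ S') : φ s S ⊆ φ s' S' := by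
  obtain ⟨x, hx⟩ := (hH.1 s).1 S hS
  obtain ⟨hm, hi⟩ := hφ s S hS
  obtain ⟨hm', hi'⟩ := hφ s' S' hS'
  exact hE.cluster_subset hm hm' (by linarith) (hi ⟨x, hx, rfl⟩) (hi' ⟨x, hSS' hx, rfl⟩)

/-- The parameter of the maximal layer point below a point of `Γ(H)` is monotone. -/
theorem maximalLayerPoint_mono {Z : Type*} {H : ℝ → Set (Set Z)} {τ : ℝ → Set Z → ℝ}
    (hτ : ∀ s S, S ∈ H s → τ s S ≤ s ∧ LayerPoint1 H (τ s S) S ∧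
      ∀ r R, LayerPoint1 H r R → r ≤ s → R ⊆ S → r ≤ τ s S) {s s' : ℝ} {S S' : Set Z}
    (hS : S ∈ H s) (hS' : S' ∈ H s') (hs : s ≤ s') (hSS' : S ⊆ S') : τ s S ≤ τ s' S' := by
  obtain ⟨hle, hl, -⟩ := hτ s S hS
  exact (hτ s' S' hS').2.2 _ _ hl (hle.trans hs) hSS'

/-- An `(ε,δ)`-interleaving `(f,g)` of closed-below single-parameter
hierarchical clusterings `(H,E)` induces, via the maps `m_H`, `m_E` to maximal layer
points (encoded by the parameter functions `tH`, `tE`), order-preserving maps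
`F : Λ(H) → Λ(E)`, `F(s,S) = m_E(s+ε, f_ε(S))` and `G : Λ(E) → Λ(H)`,
`G(t,T) = m_H(t+δ, g_δ(T))`, with `G(F(s,S)) ≤ m_H(s+ε+δ, S̄)` and
`F(G(t,T)) ≤ m_E(t+ε+δ, T̄)`. -/
theorem statement8 {Z : Type*} (H E : ℝ → Set (Set Z))
    (hH : IsHC1 H) (hE : IsHC1 E) (hHcb : ClosedBelow1 H) (hEcb : ClosedBelow1 E)
    (f g : Z → Z) (ε δ : ℝ) (hε : 0 ≤ ε) (hδ : 0 ≤ δ)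
    -- the interleaving maps `f_ε` and `g_δ` on clusters:
    (fε gδ : ℝ → Set Z → Set Z)
    (hfε : ∀ s S, S ∈ H s → fε s S ∈ E (s + ε) ∧ f '' S ⊆ fε s S)
    (hgδ : ∀ s T, T ∈ E s → gδ s T ∈ H (s + δ) ∧ g '' T ⊆ gδ s T)
    -- the interleaving diagrams commute: `g_δ(f_ε(S))` is the cluster of
    -- `H(s+ε+δ)` containing `S`, and `f_ε(g_δ(T))` is the cluster of `E(s+ε+δ)`
    -- containing `T`:
    (hcomm1 : ∀ s S, S ∈ H s → S ⊆ gδ (s + ε) (fε s S))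
    (hcomm2 : ∀ s T, T ∈ E s → T ⊆ fε (s + δ) (gδ s T))
    -- `m_H (s, S) = (tH s S, S)` is the unique maximal layer point of `H`
    -- below `(s, S)`, and similarly for `m_E`:
    (tH tE : ℝ → Set Z → ℝ)
    (htH : ∀ s S, S ∈ H s → tH s S ≤ s ∧ LayerPoint1 H (tH s S) S ∧
      ∀ r R, LayerPoint1 H r R → r ≤ s → R ⊆ S → r ≤ tH s S)
    (htE : ∀ s T, T ∈ E s → tE s T ≤ s ∧ LayerPoint1 E (tE s T) T ∧
      ∀ r R, LayerPoint1 E r R → r ≤ s → R ⊆ T → r ≤ tE s T) :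
    -- `F` is order-preserving:
    (∀ s S s' S', LayerPoint1 H s S → LayerPoint1 H s' S' → s ≤ s' → S ⊆ S' →
      tE (s + ε) (fε s S) ≤ tE (s' + ε) (fε s' S') ∧ fε s S ⊆ fε s' S') ∧
    -- `G` is order-preserving:
    (∀ t T t' T', LayerPoint1 E t T → LayerPoint1 E t' T' → t ≤ t' → T ⊆ T' →
      tH (t + δ) (gδ t T) ≤ tH (t' + δ) (gδ t' T') ∧ gδ t T ⊆ gδ t' T') ∧
    -- (i) `G(F(s,S)) ≤ m_H(s+ε+δ, S̄)` where `S̄ = g_δ(f_ε(S))` is the cluster of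
    -- `H(s+ε+δ)` containing `S`:
    (∀ s S, LayerPoint1 H s S →
      tH (tE (s + ε) (fε s S) + δ) (gδ (tE (s + ε) (fε s S)) (fε s S)) ≤
        tH (s + ε + δ) (gδ (s + ε) (fε s S)) ∧
      gδ (tE (s + ε) (fε s S)) (fε s S) ⊆ gδ (s + ε) (fε s S)) ∧
    -- (ii) `F(G(t,T)) ≤ m_E(t+ε+δ, T̄)` where `T̄ = f_ε(g_δ(T))` is the cluster of
    -- `E(t+ε+δ)` containing `T`:
    (∀ t T, LayerPoint1 E t T →
      tE (tH (t + δ) (gδ t T) + ε) (fε (tH (t + δ) (gδ t T)) (gδ t T)) ≤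
        tE (t + δ + ε) (fε (t + δ) (gδ t T)) ∧
      fε (tH (t + δ) (gδ t T)) (gδ t T) ⊆ fε (t + δ) (gδ t T)) := by
  refine ⟨fun s S s' S' hS hS' hs hSS' => ?_, fun t T t' T' hT hT' ht hTT' => ?_,
    fun s S hS => ?_, fun t T hT => ?_⟩
  · have hsub := hH.clusterMap_mono hE hfε hS.1 hS'.1 hs hSS'
    exact ⟨maximalLayerPoint_mono htE (hfε _ _ hS.1).1 (hfε _ _ hS'.1).1 (by linarith) hsub, hsub⟩
  · have hsub := hE.clusterMap_mono hH hgδ hT.1 hT'.1 ht hTT'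
    exact ⟨maximalLayerPoint_mono htH (hgδ _ _ hT.1).1 (hgδ _ _ hT'.1).1 (by linarith) hsub, hsub⟩
  · have hm := (hfε s S hS.1).1
    obtain ⟨hle, hl, -⟩ := htE _ _ hm
    have hsub := hE.clusterMap_mono hH hgδ hl.1 hm hle subset_rfl
    exact ⟨maximalLayerPoint_mono htH (hgδ _ _ hl.1).1 (hgδ _ _ hm).1 (by linarith) hsub, hsub⟩
  · have hm := (hgδ t T hT.1).1
    obtain ⟨hle, hl, -⟩ := htH _ _ hm
    have hsub := hH.clusterMap_mono hE hfε hl.1 hm hle subset_rfl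
    exact ⟨maximalLayerPoint_mono htE (hfε _ _ hl.1).1 (hfε _ _ hm).1 (by linarith) hsub, hsub⟩
end

section
/- Let X ⊆ Y be finite metric spaces with |Y| ≥ k+1 for some k ∈ ℕ, and let s, ε ≥ 0 satisfy N_k(X,Y) ≤ s + ε. Then every point of X is a vertex of the Lesnick graph L_{s+ε,k}(Y), and for every connected component S of the Vietoris–Rips graph V_s(X) there is a unique connected component T of L_{s+ε,k}(Y) with S ⊆ T. -/
open Metric in
/-- The edge relation at scale `s` of the graph with vertex set `V`
(inside an ambient metric space): an edge between distinct vertices at distance `≤ s`. -/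
def adjRel {Y : Type*} [MetricSpace Y] (V : Set Y) (s : ℝ) (a b : Y) : Prop :=
  a ∈ V ∧ b ∈ V ∧ a ≠ b ∧ dist a b ≤ s

/-- Reachability (a path of edges) in the graph with vertex set `V` and edges
between distinct vertices at distance `≤ s`. -/
def Reach {Y : Type*} [MetricSpace Y] (V : Set Y) (s : ℝ) (a b : Y) : Prop :=
  Relation.ReflTransGen (adjRel V s) a b

/-- `S` is (the vertex set of) a connected component of the graph with vertex
set `V` and edges between distinct vertices at distance `≤ s`.
For `V = X` this graph is the Vietoris–Rips graph `V_s(X)`. -/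
def IsCC {Y : Type*} [MetricSpace Y] (V : Set Y) (s : ℝ) (S : Set Y) : Prop :=
  ∃ a ∈ V, S = {b | Reach V s a b}

/-- The vertex set of the Lesnick graph `L_{s,k}(Y)`: the points of `Y` having at
least `k` distinct `s`-neighbours in `Y`. -/
def lesnickVerts (Y : Type*) [MetricSpace Y] (k : ℕ) (s : ℝ) : Set Y :=
  {y | k ≤ Set.ncard {y' : Y | y' ≠ y ∧ dist y y' ≤ s}}

/-- The directional Hausdorff distance `h(Y, X) = max_{y ∈ Y} min_{x ∈ X} d(y, x)`. -/
noncomputable def dirHaus {Y : Type*} [MetricSpace Y] (X : Set Y) : ℝ :=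
  ⨆ y : Y, ⨅ x : X, dist y (x : Y)

/-- `N_k(X, Y) = max_{x ∈ X} min_S max_{y ∈ S} d(x, y)`, the minimum over all
`(k+1)`-element subsets `S ⊆ Y`. -/
noncomputable def Nk {Y : Type*} [MetricSpace Y] (k : ℕ) (X : Set Y) : ℝ :=
  ⨆ x : X, ⨅ S : {S : Finset Y // S.card = k + 1}, ⨆ y : (S : Finset Y), dist (x : Y) (y : Y)

theorem subset_lesnickVerts_of_Nk_le {Y : Type*} [MetricSpace Y] [Fintype Y] {k : ℕ} {X : Set Y}
    (hcard : k + 1 ≤ Fintype.card Y) {r : ℝ} (hN : Nk k X ≤ r) : X ⊆ lesnickVerts Y k r := by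
  classical
  intro x hx
  have hne : Nonempty {S : Finset Y // S.card = k + 1} := by
    obtain ⟨S, -, hS⟩ := Finset.exists_subset_card_eq (s := (Finset.univ : Finset Y)) hcard
    exact ⟨⟨S, hS⟩⟩
  obtain ⟨⟨S, hS⟩, hmin⟩ := exists_eq_ciInf_of_finite
    (f := fun S : {S : Finset Y // S.card = k + 1} => ⨆ y : (S : Finset Y), dist x (y : Y))
  have hx_le := (le_ciSup (f := fun x : X => ⨅ S : {S : Finset Y // S.card = k + 1},
    ⨆ y : (S : Finset Y), dist (x : Y) (y : Y)) (Set.finite_range _).bddAbove ⟨x, hx⟩).trans hN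
  have hdist : ∀ y ∈ S, dist x y ≤ r := fun y hy =>
    ((le_ciSup (f := fun y : S => dist x (y : Y)) (Set.finite_range _).bddAbove ⟨y, hy⟩).trans
      hmin.le).trans hx_le
  have hsub : (↑(S.erase x) : Set Y) ⊆ {y' : Y | y' ≠ x ∧ dist x y' ≤ r} := by
    intro y hy
    obtain ⟨hne, hyS⟩ := Finset.mem_erase.1 (Finset.mem_coe.1 hy)
    exact ⟨hne, hdist y hyS⟩
  have hle := Set.ncard_le_ncard hsub (Set.toFinite _)
  rw [Set.ncard_coe_finset] at hle
  have hpred := Finset.pred_card_le_card_erase (s := S) (a := x)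
  change k ≤ _
  omega

theorem Reach.symm {Y : Type*} [MetricSpace Y] {V : Set Y} {s : ℝ} {a b : Y}
    (h : Reach V s a b) : Reach V s b a := by
  have : Std.Symm (adjRel V s) :=
    ⟨fun _ _ ⟨ha, hb, hne, hd⟩ => ⟨hb, ha, hne.symm, by rwa [dist_comm]⟩⟩
  exact Relation.ReflTransGen.stdSymm.symm _ _ h

theorem Reach.mono {Y : Type*} [MetricSpace Y] {V W : Set Y} {s t : ℝ} {a b : Y}
    (hVW : V ⊆ W) (hst : s ≤ t) (h : Reach V s a b) : Reach W t a b :=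
  Relation.ReflTransGen.mono
    (fun _ _ ⟨ha, hb, hne, hd⟩ => ⟨hVW ha, hVW hb, hne, hd.trans hst⟩) _ _ h

theorem IsCC.existsUnique_superset {Y : Type*} [MetricSpace Y] {V W S : Set Y} {s t : ℝ}
    (hVW : V ⊆ W) (hst : s ≤ t) (hS : IsCC V s S) : ∃! T : Set Y, IsCC W t T ∧ S ⊆ T := by
  obtain ⟨a, ha, rfl⟩ := hS
  refine ⟨{b | Reach W t a b}, ⟨⟨a, hVW ha, rfl⟩, fun b hb => Reach.mono hVW hst hb⟩, ?_⟩
  rintro T ⟨⟨c, -, rfl⟩, hsub⟩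
  have hca : Reach W t c a := hsub (show Reach V s a a from Relation.ReflTransGen.refl)
  ext b
  exact ⟨fun hcb => Relation.ReflTransGen.trans hca.symm hcb,
    fun hab => Relation.ReflTransGen.trans hca hab⟩

/-- If `X ⊆ Y` are finite metric spaces with `|Y| ≥ k+1` and
`N_k(X,Y) ≤ s + ε` (`s, ε ≥ 0`), then every point of `X` is a vertex of
`L_{s+ε,k}(Y)` and every connected component `S` of `V_s(X)` is contained in a
unique connected component `T` of `L_{s+ε,k}(Y)`. -/
theorem statement9 {Y : Type*} [MetricSpace Y] [Fintype Y] (k : ℕ) (X : Set Y)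
    (hcard : k + 1 ≤ Fintype.card Y) (s ε : ℝ) (hs : 0 ≤ s) (hε : 0 ≤ ε)
    (hN : Nk k X ≤ s + ε) :
    X ⊆ lesnickVerts Y k (s + ε) ∧
    ∀ S : Set Y, IsCC X s S →
      ∃! T : Set Y, IsCC (lesnickVerts Y k (s + ε)) (s + ε) T ∧ S ⊆ T := by
  have hsub := subset_lesnickVerts_of_Nk_le hcard hN
  exact ⟨hsub, fun _ hS => hS.existsUnique_superset hsub (le_add_of_nonneg_right hε)⟩
end

section
/- Let X ⊆ Y be finite metric spaces, k ∈ ℕ, s ≥ 0, and δ ≥ 2·h(Y,X), and let θ : Y → X satisfy d(y, θ(y)) ≤ h(Y,X) for all y ∈ Y. Then for every connected component T of the Lesnick graph L_{s,k}(Y), the image θ(T) is contained in a single connected component of the Vietoris–Rips graph V_{s+δ}(X). -/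
theorem Reach.map_of_dist_le {Y : Type*} [MetricSpace Y] {V X : Set Y} {s δ r : ℝ}
    (hδ : 2 * r ≤ δ) {θ : Y → Y} (hθX : ∀ y, θ y ∈ X) (hθ : ∀ y, dist y (θ y) ≤ r)
    {a b : Y} (h : Reach V s a b) : Reach X (s + δ) (θ a) (θ b) := by
  refine Relation.ReflTransGen.lift' θ (fun c d hcd => ?_) _ _ h
  by_cases hne : θ c = θ d
  · rw [Function.onFun, hne]
  · refine .single ⟨hθX c, hθX d, hne, ?_⟩
    have hdist := dist_triangle4 (θ c) c d (θ d)
    rw [dist_comm (θ c) c] at hdist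
    linarith [hθ c, hθ d, hcd.2.2.2]

/-- If `X ⊆ Y` are finite metric spaces, `δ ≥ 2·h(Y,X)` and
`θ : Y → X` satisfies `d(y, θ(y)) ≤ h(Y,X)`, then the `θ`-image of every connected
component of `L_{s,k}(Y)` is contained in a single connected component of
`V_{s+δ}(X)`. -/
theorem statement10 {Y : Type*} [MetricSpace Y] [Fintype Y] (k : ℕ) (X : Set Y)
    (s δ : ℝ) (hs : 0 ≤ s) (hδ : 2 * dirHaus X ≤ δ)
    (θ : Y → Y) (hθX : ∀ y, θ y ∈ X) (hθ : ∀ y, dist y (θ y) ≤ dirHaus X) :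
    ∀ T : Set Y, IsCC (lesnickVerts Y k s) s T →
      ∃ S : Set Y, IsCC X (s + δ) S ∧ θ '' T ⊆ S := by
  rintro T ⟨a, -, rfl⟩
  refine ⟨_, ⟨θ a, hθX a, rfl⟩, ?_⟩
  rintro _ ⟨b, hb, rfl⟩
  exact Reach.map_of_dist_le hδ hθX hθ hb
end

section
/- Let X be a finite metric space, let s > 0, and let S be a connected component of the Vietoris–Rips graph V_s(X) such that S is not a connected component of V_t(X) for any t with 0 ≤ t < s. Then there exist x₀, x₁ ∈ S such that for every t with 0 ≤ t < s, x₀ and x₁ lie in different connected components of V_t(X). (This is the statement that all layer points of the hierarchical clustering L₀X by components of Vietoris–Rips graphs are branch points.) -/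
/-- Reachability is monotone in the scale. -/
theorem Reach.mono_scale {Y : Type*} [MetricSpace Y] {V : Set Y} {s t : ℝ} {a b : Y}
    (h : Reach V s a b) (hst : s ≤ t) : Reach V t a b :=
  Relation.ReflTransGen.mono (r := adjRel V s) (p := adjRel V t)
    (fun _ _ ⟨hx, hy, hne, hd⟩ => ⟨hx, hy, hne, hd.trans hst⟩) a b h

/-- If `S` is a connected component of `V_s(X)` (`s > 0`) which is not
a component of `V_t(X)` for any `0 ≤ t < s`, then there are `x₀, x₁ ∈ S` lying in
different components of `V_t(X)` for every `0 ≤ t < s` (all layer points of `L₀X`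
are branch points). -/
theorem statement12 {X : Type*} [MetricSpace X] [Fintype X]
    (s : ℝ) (hs : 0 < s) (S : Set X) (hS : IsCC (Set.univ : Set X) s S)
    (hnew : ∀ t : ℝ, 0 ≤ t → t < s → ¬ IsCC (Set.univ : Set X) t S) :
    ∃ x₀ ∈ S, ∃ x₁ ∈ S, ∀ t : ℝ, 0 ≤ t → t < s →
      ¬ Reach (Set.univ : Set X) t x₀ x₁ := by
  by_contra! hcon
  obtain ⟨a, -, rfl⟩ := hS
  have hex : ∀ b : X, ∃ t : ℝ, 0 ≤ t ∧ t < s ∧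
      (Reach Set.univ s a b → Reach Set.univ t a b) := fun b => by
    by_cases hb : Reach Set.univ s a b
    · obtain ⟨t, ht0, hts, ht⟩ := hcon a Relation.ReflTransGen.refl b hb
      exact ⟨t, ht0, hts, fun _ => ht⟩
    · exact ⟨0, le_rfl, hs, fun h => absurd h hb⟩
  choose t ht0 hts ht using hex
  have : Nonempty X := ⟨a⟩
  obtain ⟨m, hm⟩ := Finite.exists_max t
  refine hnew (t m) (ht0 m) (hts m) ⟨a, Set.mem_univ a, Set.ext fun b => ?_⟩
  exact ⟨fun hb => (ht b hb).mono_scale (hm b), fun hb => hb.mono_scale (hts m).le⟩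
end

section
/- Let X be a nonempty finite metric space, let s₁ be its smallest positive phase change number (assume X has at least two points), and let c satisfy 0 ≤ c < s₁. Then the map sending a layer point (s,S) of L₀X[c] to (t,S), where t = min{r ≥ 0 : S is a connected component of V_r(X)} (this minimum exists), is an order isomorphism from Λ(L₀X[c]) onto Λ(L₀X). -/
/-- The poset `Λ(L₀X[c])` of layer points of the truncated Vietoris–Rips clustering:
pairs `(s, S)` with `s ≥ c`, `S` a connected component of `V_s(X)`, and `S` not a
component of `V_r(X)` for any `c ≤ r < s`; ordered as a subset of `ℝ × Set Y`
(componentwise: `≤` on parameters and `⊆` on clusters). `Λ(L₀X) = Λ(L₀X[0])`. -/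
def LambdaVR {Y : Type*} [MetricSpace Y] (X : Set Y) (c : ℝ) : Set (ℝ × Set Y) :=
  {p | c ≤ p.1 ∧ IsCC X p.1 p.2 ∧ ∀ r : ℝ, c ≤ r → r < p.1 → ¬ IsCC X r p.2}

/-- The poset `Λ(L_kY)` of layer points of the Lesnick clustering of `Y`:
pairs `(t, T)` with `t ≥ 0`, `T` a connected component of `L_{t,k}(Y)`, and `T` not
a component of `L_{r,k}(Y)` for any `0 ≤ r < t`; ordered componentwise. -/
def LambdaLes (Y : Type*) [MetricSpace Y] (k : ℕ) : Set (ℝ × Set Y) :=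
  {p | 0 ≤ p.1 ∧ IsCC (lesnickVerts Y k p.1) p.1 p.2 ∧
    ∀ r : ℝ, 0 ≤ r → r < p.1 → ¬ IsCC (lesnickVerts Y k r) r p.2}

theorem reach_iff_eq_of_lt {Y : Type*} [MetricSpace Y] {V : Set Y} {s₁ r : ℝ}
    (hsep : ∀ x y : Y, x ≠ y → s₁ ≤ dist x y) (hr : r < s₁) {a b : Y} :
    Reach V r a b ↔ b = a := by
  refine ⟨fun h => ?_, fun h => h ▸ Relation.ReflTransGen.refl⟩
  induction h with
  | refl => rfl
  | tail _ hbc _ =>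
    obtain ⟨-, -, hne, hd⟩ := hbc
    exact absurd (hsep _ _ hne) (by linarith)

theorem isCC_iff_singleton_of_lt {Y : Type*} [MetricSpace Y] {V : Set Y} {s₁ r : ℝ}
    (hsep : ∀ x y : Y, x ≠ y → s₁ ≤ dist x y) (hr : r < s₁) {S : Set Y} :
    IsCC V r S ↔ ∃ a ∈ V, S = {a} := by
  simp only [IsCC, reach_iff_eq_of_lt hsep hr, Set.ofPred_eq_eq_singleton]

/-- Below the separation scale `s₁` the layer points of `Λ(L₀X[c])` are the singletons at
parameter `c`; the remaining ones do not depend on `c`. -/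
theorem mem_LambdaVR_iff {Y : Type*} [MetricSpace Y] {V : Set Y} {s₁ c : ℝ}
    (hsep : ∀ x y : Y, x ≠ y → s₁ ≤ dist x y) (hcs : c < s₁) {p : ℝ × Set Y} :
    p ∈ LambdaVR V c ↔ (p.1 = c ∧ ∃ a ∈ V, p.2 = {a}) ∨
      (s₁ ≤ p.1 ∧ IsCC V p.1 p.2 ∧ ∀ r < p.1, ¬ IsCC V r p.2) := by
  constructor
  · rintro ⟨hcp, hcc, hmin⟩
    have hle : (∃ a ∈ V, p.2 = {a}) → p.1 = c := fun h =>
      (not_lt.1 fun hlt => hmin c le_rfl hlt ((isCC_iff_singleton_of_lt hsep hcs).2 h)).antisymm hcp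
    rcases lt_or_ge p.1 s₁ with hp | hp
    · have h := (isCC_iff_singleton_of_lt hsep hp).1 hcc
      exact Or.inl ⟨hle h, h⟩
    · refine Or.inr ⟨hp, hcc, fun r hr h => ?_⟩
      rcases le_or_gt c r with hcr | hcr
      · exact hmin r hcr hr h
      · have := hle ((isCC_iff_singleton_of_lt hsep (hcr.trans hcs)).1 h)
        linarith
  · rintro (⟨hp, h⟩ | ⟨hp, hcc, hmin⟩)
    · exact ⟨hp.ge, (isCC_iff_singleton_of_lt hsep (hp ▸ hcs)).2 h,
        fun r hcr hr => absurd hr (hp ▸ hcr.not_gt)⟩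
    · exact ⟨hcs.le.trans hp, hcc, fun r _ hr => hmin r hr⟩

/-- Move all parameters below `s₁` to `c'`, keeping the others. -/
noncomputable def retime (s₁ c' s : ℝ) : ℝ := if s < s₁ then c' else s

theorem retime_mono {s₁ c' : ℝ} (h : c' ≤ s₁) : Monotone (retime s₁ c') := by
  intro s t hst
  unfold retime
  split_ifs <;> linarith

theorem retime_mem_LambdaVR {Y : Type*} [MetricSpace Y] {V : Set Y} {s₁ c c' : ℝ}
    (hsep : ∀ x y : Y, x ≠ y → s₁ ≤ dist x y) (hcs : c < s₁) (hcs' : c' < s₁)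
    {p : ℝ × Set Y} (hp : p ∈ LambdaVR V c) : (retime s₁ c' p.1, p.2) ∈ LambdaVR V c' := by
  rw [mem_LambdaVR_iff hsep hcs']
  rcases (mem_LambdaVR_iff hsep hcs).1 hp with ⟨h, hS⟩ | ⟨h, hS⟩
  · exact Or.inl ⟨if_pos (h ▸ hcs), hS⟩
  · have hr : retime s₁ c' p.1 = p.1 := if_neg h.not_gt
    exact Or.inr (by simpa only [hr] using ⟨h, hS⟩)

theorem retime_retime {Y : Type*} [MetricSpace Y] {V : Set Y} {s₁ c c' : ℝ}
    (hsep : ∀ x y : Y, x ≠ y → s₁ ≤ dist x y) (hcs : c < s₁) (hcs' : c' < s₁)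
    {p : ℝ × Set Y} (hp : p ∈ LambdaVR V c) : retime s₁ c (retime s₁ c' p.1) = p.1 := by
  rcases (mem_LambdaVR_iff hsep hcs).1 hp with ⟨h, -⟩ | ⟨h, -⟩
  · simp [retime, h, hcs, hcs']
  · simp [retime, h.not_gt]

/-- The order isomorphism `Λ(L₀X[c]) ≅ Λ(L₀X[c'])` for `c`, `c'` below the separation scale. -/
noncomputable def LambdaVR.retimeIso {Y : Type*} [MetricSpace Y] (V : Set Y) {s₁ c c' : ℝ}
    (hsep : ∀ x y : Y, x ≠ y → s₁ ≤ dist x y) (hcs : c < s₁) (hcs' : c' < s₁) :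
    LambdaVR V c ≃o LambdaVR V c' :=
  Equiv.toOrderIso
    { toFun := fun p => ⟨(retime s₁ c' p.1.1, p.1.2), retime_mem_LambdaVR hsep hcs hcs' p.2⟩
      invFun := fun p => ⟨(retime s₁ c p.1.1, p.1.2), retime_mem_LambdaVR hsep hcs' hcs p.2⟩
      left_inv := fun p => Subtype.ext (Prod.ext (retime_retime hsep hcs hcs' p.2) rfl)
      right_inv := fun p => Subtype.ext (Prod.ext (retime_retime hsep hcs' hcs p.2) rfl) }
    (fun _ _ h => ⟨retime_mono hcs'.le h.1, h.2⟩)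
    (fun _ _ h => ⟨retime_mono hcs.le h.1, h.2⟩)

theorem isLeast_of_mem_LambdaVR {Y : Type*} [MetricSpace Y] {V : Set Y} {c : ℝ}
    {p : ℝ × Set Y} (hp : p ∈ LambdaVR V c) : IsLeast {r : ℝ | c ≤ r ∧ IsCC V r p.2} p.1 :=
  ⟨⟨hp.1, hp.2.1⟩, fun r hr => not_lt.1 fun hlt => hp.2.2 r hr.1 hlt hr.2⟩

/-- For `0 ≤ c < s₁` (the smallest positive phase change number of a
finite metric space `X` with at least two points), the map sending a layer point
`(s,S)` of `L₀X[c]` to `(t,S)`, where `t = min {r ≥ 0 : S is a component of V_r(X)}`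
(this minimum exists), is an order isomorphism `Λ(L₀X[c]) ≅ Λ(L₀X)`. -/
theorem statement16 {X : Type*} [MetricSpace X] [Fintype X]
    (hcard : 2 ≤ Fintype.card X) (s₁ : ℝ)
    (hs₁ : IsLeast {r : ℝ | 0 < r ∧ ∃ x x' : X, r = dist x x'} s₁)
    (c : ℝ) (hc : 0 ≤ c) (hcs : c < s₁) :
    ∃ e : (LambdaVR (Set.univ : Set X) c) ≃o (LambdaVR (Set.univ : Set X) 0),
      ∀ p : LambdaVR (Set.univ : Set X) c,
        ((e p : ℝ × Set X).2 = (p : ℝ × Set X).2) ∧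
        IsLeast {r : ℝ | 0 ≤ r ∧ IsCC (Set.univ : Set X) r (p : ℝ × Set X).2}
          (e p : ℝ × Set X).1 := by
  have hsep : ∀ x y : X, x ≠ y → s₁ ≤ dist x y := fun x y h =>
    hs₁.2 ⟨dist_pos.2 h, x, y, rfl⟩
  let e := LambdaVR.retimeIso Set.univ hsep hcs (hc.trans_lt hcs)
  exact ⟨e, fun p => ⟨rfl, isLeast_of_mem_LambdaVR (e p).2⟩⟩
end
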